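/- arXiv:2105.05282 — 2 statements merged into one kernel-verified Lean document; each statement's English description precedes it below -/
import Mathlib

section
/- Let n ≥ 2, 1 < p < n, and 0 < q < p − 1, and let σ be a positive Radon measure on ℝⁿ. Then for every x ∈ ℝⁿ, every R > 0, and every y ∈ B(x,R), one has K_{p,q} σ(y) ≥ 2^{−(n−p)/(p−1)} · ∫_R^∞ ( κ(B(x,r))^{q(p−1)/(p−1−q)} / r^{n−p} )^{1/(p−1)} dr/r. -/
open MeasureTheory Metric Set
open scoped ENNReal NNReal

/-- The Wolff potential `W_p μ(x) = ∫₀^∞ (μ(B(x,ρ))/ρ^{n-p})^{1/(p-1)} dρ/ρ`. -/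
noncomputable def wolff (n : ℕ) (p : ℝ) (μ : Measure (EuclideanSpace ℝ (Fin n)))
    (x : EuclideanSpace ℝ (Fin n)) : ℝ≥0∞ :=
  ∫⁻ r in Ioi (0 : ℝ),
    (μ (ball x r) / ENNReal.ofReal (r ^ ((n : ℝ) - p))) ^ (1 / (p - 1)) * ENNReal.ofReal (1 / r)

/-- `κ(B)`: the least constant (possibly `∞`) such that
`(∫_B (W_p ν)^q dσ)^{1/q} ≤ κ(B) · ν(ℝⁿ)^{1/(p-1)}` for every finite positive
Radon measure `ν`. -/
noncomputable def kappa (n : ℕ) (p q : ℝ) (σ : Measure (EuclideanSpace ℝ (Fin n)))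
    (B : Set (EuclideanSpace ℝ (Fin n))) : ℝ≥0∞ :=
  sInf {c : ℝ≥0∞ | ∀ ν : Measure (EuclideanSpace ℝ (Fin n)), IsFiniteMeasure ν →
    (∫⁻ y in B, wolff n p ν y ^ q ∂σ) ^ (1 / q) ≤ c * ν Set.univ ^ (1 / (p - 1))}

/-- The intrinsic nonlinear potential
`K_{p,q} σ(x) = ∫₀^∞ (κ(B(x,r))^{q(p-1)/(p-1-q)} / r^{n-p})^{1/(p-1)} dr/r`. -/
noncomputable def intrinsicK (n : ℕ) (p q : ℝ) (σ : Measure (EuclideanSpace ℝ (Fin n)))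
    (x : EuclideanSpace ℝ (Fin n)) : ℝ≥0∞ :=
  ∫⁻ r in Ioi (0 : ℝ),
    (kappa n p q σ (ball x r) ^ (q * (p - 1) / (p - 1 - q)) /
        ENNReal.ofReal (r ^ ((n : ℝ) - p))) ^ (1 / (p - 1)) * ENNReal.ofReal (1 / r)

/-- `kappa` is monotone with respect to inclusion of sets. -/
theorem kappa_mono {n : ℕ} {p q : ℝ} (hq : 0 < q) (σ : Measure (EuclideanSpace ℝ (Fin n)))
    {A B : Set (EuclideanSpace ℝ (Fin n))} (h : A ⊆ B) : kappa n p q σ A ≤ kappa n p q σ B :=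
  sInf_le_sInf fun _ hc ν hν =>
    (ENNReal.rpow_le_rpow (lintegral_mono_set h) (one_div_pos.2 hq).le).trans (hc ν hν)

/-- Dilation of the variable in a lower Lebesgue integral over a half-line. -/
theorem lintegral_Ioi_comp_two_mul (f : ℝ → ℝ≥0∞) (R : ℝ) :
    ∫⁻ r in Ioi (2 * R), f r = ∫⁻ r in Ioi R, ENNReal.ofReal 2 * f (2 * r) := by
  have himage : (fun r : ℝ => 2 * r) '' Ioi R = Ioi (2 * R) :=
    Set.image_mul_left_Ioi two_pos R
  have hderiv : ∀ r ∈ Ioi R, HasDerivWithinAt (fun r : ℝ => 2 * r) 2 (Ioi R) r := fun r _ => by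
    simpa using ((hasDerivAt_id r).const_mul (2 : ℝ)).hasDerivWithinAt
  have h := lintegral_image_eq_lintegral_abs_deriv_mul measurableSet_Ioi hderiv
    (mul_right_injective₀ (two_ne_zero' ℝ)).injOn f
  rwa [himage, abs_of_pos two_pos] at h

/-- Effect of doubling the radius on the integrand of a Wolff-type potential. -/
theorem div_ofReal_two_mul_rpow (k : ℝ≥0∞) {r a s : ℝ} (hr : 0 < r) (hs : 0 < s) :
    (k / ENNReal.ofReal ((2 * r) ^ a)) ^ (1 / s) =
      ENNReal.ofReal ((2 : ℝ) ^ (-a / s)) * (k / ENNReal.ofReal (r ^ a)) ^ (1 / s) := by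
  have hs' : 0 ≤ 1 / s := (one_div_pos.2 hs).le
  have h2 : (0 : ℝ) < 2 ^ a := Real.rpow_pos_of_pos two_pos a
  have hsplit : k / ENNReal.ofReal ((2 * r) ^ a) =
      ENNReal.ofReal ((2 : ℝ) ^ (-a)) * (k / ENNReal.ofReal (r ^ a)) := by
    rw [Real.mul_rpow zero_le_two hr.le, ENNReal.ofReal_mul h2.le, div_eq_mul_inv,
      ENNReal.mul_inv (Or.inr ENNReal.ofReal_ne_top) (Or.inl ENNReal.ofReal_ne_top),
      Real.rpow_neg zero_le_two, ENNReal.ofReal_inv_of_pos h2, div_eq_mul_inv]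
    ring
  rw [hsplit, ENNReal.mul_rpow_of_nonneg _ _ hs',
    ENNReal.ofReal_rpow_of_nonneg (Real.rpow_nonneg zero_le_two _) hs',
    ← Real.rpow_mul zero_le_two, mul_one_div]

/-- Lower bound for the intrinsic potential at points of `B(x,R)` by the tail of its
defining integral centred at `x`. -/
theorem stmt13 (n : ℕ) (hn : 2 ≤ n) (p q : ℝ) (hp : 1 < p) (hpn : p < n)
    (hq : 0 < q) (hqp : q < p - 1)
    (σ : Measure (EuclideanSpace ℝ (Fin n))) (hσ : IsLocallyFiniteMeasure σ)
    (x : EuclideanSpace ℝ (Fin n)) (R : ℝ) (hR : 0 < R)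
    (y : EuclideanSpace ℝ (Fin n)) (hy : y ∈ ball x R) :
    ENNReal.ofReal ((2 : ℝ) ^ (-((n : ℝ) - p) / (p - 1))) *
        ∫⁻ r in Ioi R,
          (kappa n p q σ (ball x r) ^ (q * (p - 1) / (p - 1 - q)) /
              ENNReal.ofReal (r ^ ((n : ℝ) - p))) ^ (1 / (p - 1)) *
            ENNReal.ofReal (1 / r) ≤
      intrinsicK n p q σ y := by
  have hs : 0 < p - 1 := by linarith
  have hexp : 0 ≤ q * (p - 1) / (p - 1 - q) := div_nonneg (mul_pos hq hs).le (by linarith)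
  rw [← lintegral_const_mul' _ _ ENNReal.ofReal_ne_top]
  refine le_trans ?_ (lintegral_mono_set (Ioi_subset_Ioi (by positivity : (0 : ℝ) ≤ 2 * R)))
  rw [lintegral_Ioi_comp_two_mul]
  refine setLIntegral_mono' measurableSet_Ioi fun r hr => ?_
  have hRr : R < r := hr
  have hr0 : 0 < r := hR.trans hRr
  have hball : ball x r ⊆ ball y (2 * r) := ball_subset_ball' (by
    have := mem_ball'.1 hy
    linarith)
  have hcancel : ENNReal.ofReal 2 * ENNReal.ofReal (1 / (2 * r)) = ENNReal.ofReal (1 / r) := by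
    rw [← ENNReal.ofReal_mul zero_le_two]
    congr 1
    field_simp
  rw [div_ofReal_two_mul_rpow _ hr0 hs, mul_left_comm (ENNReal.ofReal 2), hcancel, mul_assoc]
  gcongr
  exact kappa_mono hq σ hball
end

section
/- Let n ≥ 2 and 1 < p < n. There is a constant C depending only on p and n such that for all positive Radon measures μ, σ on ℝⁿ, Σ_{k ∈ ℤ} Σ_{m ∈ ℤⁿ} ( σ(Q_{k,m}) / 2^{k(n−p)} )^{1/(p−1)} · μ(Q*_{k,m}) ≤ C · ∫_{ℝⁿ} W_p σ(x) dμ(x), where the sum is over all dyadic cubes. -/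
open MeasureTheory Metric Set
open scoped ENNReal NNReal

/-- The dyadic cube `Q_{k,m} = ∏ᵢ [2^k mᵢ, 2^k (mᵢ+1))` of side length `2^k`. -/
def dyadicCube (n : ℕ) (k : ℤ) (m : Fin n → ℤ) : Set (EuclideanSpace ℝ (Fin n)) :=
  {x | ∀ i, (2 : ℝ) ^ k * (m i : ℝ) ≤ x i ∧ x i < (2 : ℝ) ^ k * ((m i : ℝ) + 1)}

/-- The cube `Q*_{k,m} = ∏ᵢ [2^k (mᵢ-1), 2^k (mᵢ+2))`, concentric with `Q_{k,m}` and of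
side length `3·2^k`. -/
def dyadicStar (n : ℕ) (k : ℤ) (m : Fin n → ℤ) : Set (EuclideanSpace ℝ (Fin n)) :=
  {x | ∀ i, (2 : ℝ) ^ k * ((m i : ℝ) - 1) ≤ x i ∧ x i < (2 : ℝ) ^ k * ((m i : ℝ) + 2)}

theorem measurableSet_dyadicStar (n : ℕ) (k : ℤ) (m : Fin n → ℤ) :
    MeasurableSet (dyadicStar n k m) := by
  unfold dyadicStar
  measurability

/-- A point of `Q*` sees all of `Q` within distance `2 n 2^k`. -/
theorem dyadicCube_subset_ball {n : ℕ} (hn : 2 ≤ n) {k : ℤ} {m : Fin n → ℤ}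
    {x : EuclideanSpace ℝ (Fin n)} (hx : x ∈ dyadicStar n k m) :
    dyadicCube n k m ⊆ ball x (2 * n * (2 : ℝ) ^ k) := by
  intro y hy
  have hk : (0 : ℝ) < 2 ^ k := by positivity
  have hn2 : (2 : ℝ) ≤ n := by exact_mod_cast hn
  rw [mem_ball, EuclideanSpace.dist_eq, Real.sqrt_lt' (by positivity)]
  have hcoord : ∀ i, dist (y i) (x i) ^ 2 ≤ (2 * (2 : ℝ) ^ k) ^ 2 := by
    intro i
    have h₁ := hx i
    have h₂ := hy i
    refine pow_le_pow_left₀ dist_nonneg ?_ 2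
    rw [Real.dist_eq, abs_le]
    constructor <;> nlinarith
  calc ∑ i, dist (y i) (x i) ^ 2 ≤ ∑ _i : Fin n, (2 * (2 : ℝ) ^ k) ^ 2 :=
        Finset.sum_le_sum fun i _ => hcoord i
    _ = n * (2 * (2 : ℝ) ^ k) ^ 2 := by simp
    _ < (2 * n * (2 : ℝ) ^ k) ^ 2 := by
        have : 0 < (2 * (2 : ℝ) ^ k) ^ 2 := by positivity
        nlinarith

/-- The cubes `Q*` of a given generation overlap at most `3^n` times. -/
theorem tsum_indicator_dyadicStar_le (n : ℕ) (k : ℤ) (x : EuclideanSpace ℝ (Fin n)) (a : ℝ≥0∞)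
    (f : (Fin n → ℤ) → ℝ≥0∞) (hf : ∀ m, x ∈ dyadicStar n k m → f m ≤ a) :
    ∑' m, (dyadicStar n k m).indicator (fun _ => f m) x ≤ 3 ^ n * a := by
  have hk : (0 : ℝ) < 2 ^ k := by positivity
  set s : Finset (Fin n → ℤ) :=
    Fintype.piFinset fun i => Finset.Icc (⌊x i / 2 ^ k⌋ - 1) (⌊x i / 2 ^ k⌋ + 1) with hs
  have hmem : ∀ m, x ∈ dyadicStar n k m → m ∈ s := by
    intro m hm
    rw [hs, Fintype.mem_piFinset]
    intro i
    obtain ⟨h₁, h₂⟩ := hm i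
    rw [← le_div_iff₀' hk] at h₁
    rw [← div_lt_iff₀' hk] at h₂
    have h₃ : m i - 1 ≤ ⌊x i / 2 ^ k⌋ := Int.le_floor.2 (by push_cast; exact h₁)
    have h₄ : ⌊x i / 2 ^ k⌋ < m i + 2 := Int.floor_lt.2 (by push_cast; exact h₂)
    rw [Finset.mem_Icc]
    omega
  have hcard : s.card = 3 ^ n := by
    have h (z : ℤ) : (Finset.Icc (z - 1) (z + 1)).card = 3 := by
      rw [Int.card_Icc]
      omega
    simp only [hs, Fintype.card_piFinset, h, Finset.prod_const, Finset.card_univ,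
      Fintype.card_fin]
  rw [tsum_eq_sum (s := s) fun m hm => indicator_of_notMem (fun h => hm (hmem m h)) _]
  refine (Finset.sum_le_card_nsmul s _ a fun m _ => ?_).trans_eq (by rw [hcard]; simp)
  by_cases hm : x ∈ dyadicStar n k m
  · simpa [hm] using hf m hm
  · simp [hm]

/-- The part of the Wolff potential on `[r, 2r)` controls the value of its integrand at `r`. -/
theorem le_setLIntegral_wolff_integrand {n : ℕ} {p : ℝ} (hp : 1 < p) (hpn : p < n)
    (σ : Measure (EuclideanSpace ℝ (Fin n))) (x : EuclideanSpace ℝ (Fin n)) {r : ℝ} (hr : 0 < r) :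
    (σ (ball x r) / ENNReal.ofReal ((2 * r) ^ ((n : ℝ) - p))) ^ (1 / (p - 1)) ≤
      2 * ∫⁻ ρ in Ico r (2 * r),
        (σ (ball x ρ) / ENNReal.ofReal (ρ ^ ((n : ℝ) - p))) ^ (1 / (p - 1)) *
          ENNReal.ofReal (1 / ρ) := by
  have hq : 0 ≤ 1 / (p - 1) := by
    have : 0 < p - 1 := by linarith
    positivity
  set a := (σ (ball x r) / ENNReal.ofReal ((2 * r) ^ ((n : ℝ) - p))) ^ (1 / (p - 1))
  have hconst : 2 * ∫⁻ _ρ in Ico r (2 * r), a * ENNReal.ofReal (1 / (2 * r)) = a := by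
    have h2 : (2 : ℝ≥0∞) = ENNReal.ofReal 2 := by simp
    rw [setLIntegral_const, Real.volume_Ico, mul_assoc, ← ENNReal.ofReal_mul (by positivity),
      mul_left_comm, h2, ← ENNReal.ofReal_mul (by positivity)]
    have : 2 * (1 / (2 * r) * (2 * r - r)) = 1 := by field_simp; ring
    rw [this]
    simp
  rw [← hconst]
  gcongr 2 * ?_
  refine setLIntegral_mono' measurableSet_Ico fun ρ hρ => ?_
  have hρ0 : 0 < ρ := hr.trans_le hρ.1
  refine mul_le_mul' (ENNReal.rpow_le_rpow (ENNReal.div_le_div ?_ ?_) hq) ?_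
  · exact measure_mono (ball_subset_ball hρ.1)
  · exact ENNReal.ofReal_le_ofReal
      (Real.rpow_le_rpow hρ0.le hρ.2.le (by linarith))
  · exact ENNReal.ofReal_le_ofReal (one_div_le_one_div_of_le hρ0 hρ.2.le)

theorem tsum_setLIntegral_dyadic_le {c : ℝ} (hc : 0 < c) (g : ℝ → ℝ≥0∞) :
    ∑' k : ℤ, ∫⁻ ρ in Ico (c * 2 ^ k) (2 * (c * 2 ^ k)), g ρ ≤ ∫⁻ ρ in Ioi (0 : ℝ), g ρ := by
  have hmono : Monotone fun k : ℤ => c * (2 : ℝ) ^ k := fun a b hab =>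
    mul_le_mul_of_nonneg_left (zpow_le_zpow_right₀ (by norm_num) hab) hc.le
  have heq (k : ℤ) : 2 * (c * (2 : ℝ) ^ k) = c * 2 ^ (Order.succ k) := by
    rw [Order.succ_eq_add_one, zpow_add_one₀ (by norm_num)]
    ring
  simp only [heq]
  rw [← lintegral_iUnion (fun _ => measurableSet_Ico) hmono.pairwise_disjoint_on_Ico_succ]
  refine lintegral_mono_set (iUnion_subset fun k ρ hρ => ?_)
  exact lt_of_lt_of_le (by positivity) hρ.1

theorem tsum_dyadic_le_wolff {n : ℕ} (hn : 2 ≤ n) {p : ℝ} (hp : 1 < p) (hpn : p < n)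
    (σ : Measure (EuclideanSpace ℝ (Fin n))) (x : EuclideanSpace ℝ (Fin n)) :
    ∑' (k : ℤ) (m : Fin n → ℤ), (dyadicStar n k m).indicator (fun _ =>
        (σ (dyadicCube n k m) /
          ENNReal.ofReal ((2 : ℝ) ^ ((k : ℝ) * ((n : ℝ) - p)))) ^ (1 / (p - 1))) x ≤
      ENNReal.ofReal (3 ^ n * (((4 * n : ℝ) ^ ((n : ℝ) - p)) ^ (1 / (p - 1)) * 2)) *
        wolff n p σ x := by
  have hq : 0 ≤ 1 / (p - 1) := by
    have : 0 < p - 1 := by linarith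
    positivity
  have hn0 : (0 : ℝ) < n := by positivity
  set D : ℝ := (4 * n : ℝ) ^ ((n : ℝ) - p) with hD
  have hD0 : 0 < D := by positivity
  have hsplit : ENNReal.ofReal (3 ^ n * (D ^ (1 / (p - 1)) * 2)) =
      3 ^ n * (ENNReal.ofReal D ^ (1 / (p - 1)) * 2) := by
    rw [ENNReal.ofReal_mul (by positivity), ENNReal.ofReal_mul (by positivity),
      ENNReal.ofReal_rpow_of_pos hD0, ENNReal.ofReal_pow (by positivity)]
    simp
  set g : ℝ → ℝ≥0∞ := fun ρ =>
    (σ (ball x ρ) / ENNReal.ofReal (ρ ^ ((n : ℝ) - p))) ^ (1 / (p - 1)) * ENNReal.ofReal (1 / ρ)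
  have hlevel (k : ℤ) : ∑' m : Fin n → ℤ, (dyadicStar n k m).indicator (fun _ =>
        (σ (dyadicCube n k m) /
          ENNReal.ofReal ((2 : ℝ) ^ ((k : ℝ) * ((n : ℝ) - p)))) ^ (1 / (p - 1))) x ≤
      3 ^ n * (ENNReal.ofReal D ^ (1 / (p - 1)) * 2) *
        ∫⁻ ρ in Ico (2 * n * (2 : ℝ) ^ k) (2 * (2 * n * 2 ^ k)), g ρ := by
    have hr : 0 < 2 * n * (2 : ℝ) ^ k := by positivity
    have hpow : (2 * (2 * n * (2 : ℝ) ^ k)) ^ ((n : ℝ) - p) =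
        D * (2 : ℝ) ^ ((k : ℝ) * ((n : ℝ) - p)) := by
      rw [hD, Real.rpow_mul (by norm_num), Real.rpow_intCast,
        ← Real.mul_rpow (by positivity) (by positivity)]
      congr 1
      ring
    rw [mul_assoc, mul_assoc]
    refine tsum_indicator_dyadicStar_le n k x _ _ fun m hm => ?_
    calc _ ≤ (ENNReal.ofReal D * (σ (ball x (2 * n * (2 : ℝ) ^ k)) /
            ENNReal.ofReal ((2 * (2 * n * (2 : ℝ) ^ k)) ^ ((n : ℝ) - p)))) ^ (1 / (p - 1)) := by
          refine ENNReal.rpow_le_rpow ?_ hq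
          rw [hpow, ENNReal.ofReal_mul hD0.le, ← mul_div_assoc,
            ENNReal.mul_div_mul_left _ _ (by simpa using hD0) ENNReal.ofReal_ne_top]
          exact ENNReal.div_le_div_right (measure_mono (dyadicCube_subset_ball hn hm)) _
      _ ≤ _ := by
          rw [ENNReal.mul_rpow_of_nonneg _ _ hq]
          exact mul_le_mul_right (le_setLIntegral_wolff_integrand hp hpn σ x hr) _
  calc _ ≤ ∑' k : ℤ, 3 ^ n * (ENNReal.ofReal D ^ (1 / (p - 1)) * 2) *
        ∫⁻ ρ in Ico (2 * n * (2 : ℝ) ^ k) (2 * (2 * n * 2 ^ k)), g ρ :=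
        ENNReal.tsum_le_tsum hlevel
    _ ≤ _ := by
        rw [ENNReal.tsum_mul_left, hsplit]
        exact mul_le_mul_right (tsum_setLIntegral_dyadic_le (by positivity) g) _

/-- The dyadic pairing bound
`Σ_{k,m} (σ(Q_{k,m})/2^{k(n-p)})^{1/(p-1)} μ(Q*_{k,m}) ≤ C ∫ W_p σ dμ`
with `C = C(p,n)`. -/
theorem stmt16 (n : ℕ) (hn : 2 ≤ n) (p : ℝ) (hp : 1 < p) (hpn : p < n) :
    ∃ C : ℝ, 0 < C ∧
      ∀ μ σ : Measure (EuclideanSpace ℝ (Fin n)),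
        IsLocallyFiniteMeasure μ → IsLocallyFiniteMeasure σ →
        (∑' (k : ℤ) (m : Fin n → ℤ),
          (σ (dyadicCube n k m) /
              ENNReal.ofReal ((2 : ℝ) ^ ((k : ℝ) * ((n : ℝ) - p)))) ^ (1 / (p - 1)) *
            μ (dyadicStar n k m)) ≤
          ENNReal.ofReal C * ∫⁻ x, wolff n p σ x ∂μ := by
  refine ⟨3 ^ n * (((4 * n : ℝ) ^ ((n : ℝ) - p)) ^ (1 / (p - 1)) * 2), by positivity, ?_⟩
  intro μ σ _ _
  have hmeas (k : ℤ) (m : Fin n → ℤ) (c : ℝ≥0∞) :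
      Measurable ((dyadicStar n k m).indicator fun _ => c) :=
    measurable_const.indicator (measurableSet_dyadicStar n k m)
  rw [← lintegral_const_mul' _ _ ENNReal.ofReal_ne_top]
  refine le_trans (le_of_eq ?_) (lintegral_mono fun x => tsum_dyadic_le_wolff hn hp hpn σ x)
  rw [lintegral_tsum fun k => (Measurable.tsum fun m => hmeas k m _).aemeasurable]
  refine tsum_congr fun k => ?_
  rw [lintegral_tsum fun m => (hmeas k m _).aemeasurable]
  exact tsum_congr fun m => (lintegral_indicator_const (measurableSet_dyadicStar n k m) _).symm
end
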